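/- Let ε = e^{2πi/5} ∈ ℂ and let f, H, T be the icosahedral invariant polynomials. Every polynomial p ∈ ℂ[z₁,z₂] invariant under the two substitutions (z₁,z₂) ↦ (ε³z₁, ε²z₂) and (z₁,z₂) ↦ ((−(ε−ε⁴)z₁ + (ε²−ε³)z₂)/√5, ((ε²−ε³)z₁ + (ε−ε⁴)z₂)/√5) lies in the ℂ-subalgebra of ℂ[z₁,z₂] generated by f, H and T. -/

import Mathlib

open Complex MvPolynomial

/-- The degree-12 icosahedral invariant `f`. -/
noncomputable def icosF : MvPolynomial (Fin 2) ℂ :=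
  X 0 * X 1 * ((X 0) ^ 10 + 11 * (X 0) ^ 5 * (X 1) ^ 5 - (X 1) ^ 10)

/-- The degree-20 icosahedral invariant `H`. -/
noncomputable def icosH : MvPolynomial (Fin 2) ℂ :=
  -((X 0) ^ 20 + (X 1) ^ 20) + 228 * ((X 0) ^ 15 * (X 1) ^ 5 - (X 0) ^ 5 * (X 1) ^ 15)
    - 494 * (X 0) ^ 10 * (X 1) ^ 10

/-- The degree-30 icosahedral invariant `T`. -/
noncomputable def icosT : MvPolynomial (Fin 2) ℂ :=
  ((X 0) ^ 30 + (X 1) ^ 30) + 522 * ((X 0) ^ 25 * (X 1) ^ 5 - (X 0) ^ 5 * (X 1) ^ 25)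
    - 10005 * ((X 0) ^ 20 * (X 1) ^ 10 + (X 0) ^ 10 * (X 1) ^ 20)


set_option maxRecDepth 100000 in
set_option linter.unusedSimpArgs false in
set_option maxHeartbeats 8000000 in
theorem icos_ids0 (φ x y : ℂ) (h2 : φ ^ 2 = φ + 1) :
    (φ - 3)^5 * (-φ*x+y)^10 =
      (-450 + 275 * φ) * x ^ 0 * y ^ 10 + (-2750 + 1750 * φ) * x ^ 1 * y ^ 9 + (-7875 + 4500 * φ) * x ^ 2 * y ^ 8
        + (-12000 + 9000 * φ) * x ^ 3 * y ^ 7 + (-15750 + 5250 * φ) * x ^ 4 * y ^ 6 + (-6300 + 12600 * φ) * x ^ 5 * y ^ 5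
        + (-10500 - 5250 * φ) * x ^ 6 * y ^ 4 + (3000 + 9000 * φ) * x ^ 7 * y ^ 3 + (-3375 - 4500 * φ) * x ^ 8 * y ^ 2
        + (1000 + 1750 * φ) * x ^ 9 * y ^ 1 + (-175 - 275 * φ) * x ^ 10 * y ^ 0 ∧
    (φ - 3)^5 * ((-φ*x+y)^5 * (x+φ*y)^5) =
      (25 - 50 * φ) * x ^ 0 * y ^ 10 + (-125 + 250 * φ) * x ^ 1 * y ^ 9 + (125 - 250 * φ) * x ^ 2 * y ^ 8
        + (250 - 500 * φ) * x ^ 3 * y ^ 7 + (-375 + 750 * φ) * x ^ 4 * y ^ 6 + (-275 + 550 * φ) * x ^ 5 * y ^ 5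
        + (375 - 750 * φ) * x ^ 6 * y ^ 4 + (250 - 500 * φ) * x ^ 7 * y ^ 3 + (-125 + 250 * φ) * x ^ 8 * y ^ 2
        + (-125 + 250 * φ) * x ^ 9 * y ^ 1 + (-25 + 50 * φ) * x ^ 10 * y ^ 0 ∧
    (φ - 3)^5 * (x+φ*y)^10 =
      (-175 - 275 * φ) * x ^ 0 * y ^ 10 + (-1000 - 1750 * φ) * x ^ 1 * y ^ 9 + (-3375 - 4500 * φ) * x ^ 2 * y ^ 8
        + (-3000 - 9000 * φ) * x ^ 3 * y ^ 7 + (-10500 - 5250 * φ) * x ^ 4 * y ^ 6 + (6300 - 12600 * φ) * x ^ 5 * y ^ 5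
        + (-15750 + 5250 * φ) * x ^ 6 * y ^ 4 + (12000 - 9000 * φ) * x ^ 7 * y ^ 3 + (-7875 + 4500 * φ) * x ^ 8 * y ^ 2
        + (2750 - 1750 * φ) * x ^ 9 * y ^ 1 + (-450 + 275 * φ) * x ^ 10 * y ^ 0 := by
  have h3 : φ ^ 3 = 2 * φ + 1 := by
    linear_combination φ * h2 + 1 * h2
  have h4 : φ ^ 4 = 3 * φ + 2 := by
    linear_combination φ * h3 + 2 * h2
  have h5 : φ ^ 5 = 5 * φ + 3 := by
    linear_combination φ * h4 + 3 * h2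
  have h6 : φ ^ 6 = 8 * φ + 5 := by
    linear_combination φ * h5 + 5 * h2
  have h7 : φ ^ 7 = 13 * φ + 8 := by
    linear_combination φ * h6 + 8 * h2
  have h8 : φ ^ 8 = 21 * φ + 13 := by
    linear_combination φ * h7 + 13 * h2
  have h9 : φ ^ 9 = 34 * φ + 21 := by
    linear_combination φ * h8 + 21 * h2
  have h10 : φ ^ 10 = 55 * φ + 34 := by
    linear_combination φ * h9 + 34 * h2
  have h11 : φ ^ 11 = 89 * φ + 55 := by
    linear_combination φ * h10 + 55 * h2
  have h12 : φ ^ 12 = 144 * φ + 89 := by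
    linear_combination φ * h11 + 89 * h2
  have h13 : φ ^ 13 = 233 * φ + 144 := by
    linear_combination φ * h12 + 144 * h2
  have h14 : φ ^ 14 = 377 * φ + 233 := by
    linear_combination φ * h13 + 233 * h2
  have h15 : φ ^ 15 = 610 * φ + 377 := by
    linear_combination φ * h14 + 377 * h2
  refine ⟨?_, ?_, ?_⟩
  all_goals
    ring_nf
    simp only [h2, h3, h4, h5, h6, h7, h8, h9, h10, h11, h12, h13, h14, h15]
    ring

set_option maxRecDepth 100000 in
set_option linter.unusedSimpArgs false in
set_option linter.unreachableTactic false in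
set_option linter.unusedTactic false in
set_option maxHeartbeats 8000000 in
theorem icos_ids (φ x y : ℂ) (h2 : φ ^ 2 = φ + 1) :
    (φ-3)^6*((-φ*x+y)*(x+φ*y)*((-φ*x+y)^10+11*(-φ*x+y)^5*(x+φ*y)^5-(x+φ*y)^10)) =
      5^6*(x*y*(x^10+11*x^5*y^5-y^10)) ∧
    (φ-3)^10*(-((-φ*x+y)^20+(x+φ*y)^20)+228*((-φ*x+y)^15*(x+φ*y)^5-(-φ*x+y)^5*(x+φ*y)^15)
        -494*(-φ*x+y)^10*(x+φ*y)^10) =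
      5^10*(-(x^20+y^20)+228*(x^15*y^5-x^5*y^15)-494*x^10*y^10) ∧
    (φ-3)^15*(((-φ*x+y)^30+(x+φ*y)^30)+522*((-φ*x+y)^25*(x+φ*y)^5-(-φ*x+y)^5*(x+φ*y)^25)
        -10005*((-φ*x+y)^20*(x+φ*y)^10+(-φ*x+y)^10*(x+φ*y)^20)) =
      5^15*((x^30+y^30)+522*(x^25*y^5-x^5*y^25)-10005*(x^20*y^10+x^10*y^20)) := by
  obtain ⟨h1, hm, hr⟩ := icos_ids0 φ x y h2
  have h3 : φ ^ 3 = 2 * φ + 1 := by linear_combination (φ + 1) * h2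
  have h4 : φ ^ 4 = 3 * φ + 2 := by linear_combination φ * h3 + 2 * h2
  have e1 : ∀ u v : ℂ, (φ-3)^6*(u*v*(u^10+11*u^5*v^5-v^10)) =
      (φ-3)*u*v*((φ-3)^5*u^10+11*((φ-3)^5*(u^5*v^5))-(φ-3)^5*v^10) := by intros; ring
  have e2 : ∀ u v : ℂ, (φ-3)^10*(-(u^20+v^20)+228*(u^15*v^5-u^5*v^15)-494*u^10*v^10) =
      -(((φ-3)^5*u^10)^2+((φ-3)^5*v^10)^2)
        +228*((φ-3)^5*(u^5*v^5))*((φ-3)^5*u^10-(φ-3)^5*v^10)-494*((φ-3)^5*(u^5*v^5))^2 := by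
    intros; ring
  have e3 : ∀ u v : ℂ, (φ-3)^15*((u^30+v^30)+522*(u^25*v^5-u^5*v^25)
        -10005*(u^20*v^10+u^10*v^20)) =
      ((φ-3)^5*u^10+(φ-3)^5*v^10) * (((φ-3)^5*u^10)^2+((φ-3)^5*v^10)^2
        +522*((φ-3)^5*(u^5*v^5))*((φ-3)^5*u^10-(φ-3)^5*v^10)-10006*((φ-3)^5*(u^5*v^5))^2) := by
    intros; ring
  refine ⟨?_, ?_, ?_⟩
  · rw [e1, h1, hm, hr]
    ring_nf
    simp only [h2, h3, h4]
    ring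
  · rw [e2, h1, hm, hr]
    ring_nf
    simp only [h2, h3, h4]
    try ring
  · rw [e3, h1, hm, hr]
    ring_nf
    simp only [h2, h3, h4]
    try ring

theorem hom_aeval {A : Type*} [CommRing A] [Algebra ℂ A] {p : MvPolynomial (Fin 2) ℂ} {n : ℕ}
    (hp : p.IsHomogeneous n) (a b : ℂ) (t : A) :
    aeval ![algebraMap ℂ A a * t, algebraMap ℂ A b * t] p
      = algebraMap ℂ A (eval ![a, b] p) * t ^ n := by
  rw [aeval_def, eval₂_eq', eval_eq', map_sum, Finset.sum_mul]
  refine Finset.sum_congr rfl fun d hd => ?_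
  have h := hp.degree_eq_sum_deg_support hd
  have h' : d 0 + d 1 = n := by
    rw [h]; change _ = d.degree; rw [Finsupp.degree_eq_sum]; simp
  subst h'
  simp [Fin.prod_univ_two]
  ring

theorem hom_eval {p : MvPolynomial (Fin 2) ℂ} {n : ℕ}
    (hp : p.IsHomogeneous n) (a b t : ℂ) :
    eval ![t * a, t * b] p = t ^ n * eval ![a, b] p := by
  have := hom_aeval hp a b t
  simp only [Algebra.algebraMap_self, RingHom.id_apply, ← coe_aeval_eq_eval] at this
  rw [mul_comm t a, mul_comm t b, mul_comm (t ^ n)]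
  exact this

theorem aeval_sub_dvd (p : MvPolynomial (Fin 2) ℂ) (g : Fin 2 → MvPolynomial (Fin 2) ℂ)
    (l : MvPolynomial (Fin 2) ℂ) (h : ∀ i, l ∣ X i - g i) : l ∣ p - aeval g p := by
  rw [← Ideal.mem_span_singleton, ← Ideal.Quotient.eq]
  have : (Ideal.Quotient.mkₐ ℂ (Ideal.span {l})) = (Ideal.Quotient.mkₐ ℂ (Ideal.span {l})).comp (aeval g) := by
    apply MvPolynomial.algHom_ext
    intro i
    simp only [AlgHom.comp_apply, aeval_X, Ideal.Quotient.mkₐ_eq_mk]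
    rw [Ideal.Quotient.eq, Ideal.mem_span_singleton]
    exact h i
  exact DFunLike.congr_fun this p

/-- Restriction to the line `x = r y`. -/
noncomputable def lineRes (r : ℂ) : MvPolynomial (Fin 2) ℂ →ₐ[ℂ] Polynomial ℂ :=
  aeval ![Polynomial.C r * Polynomial.X, Polynomial.X]

theorem lineRes_dvd (r : ℂ) (p : MvPolynomial (Fin 2) ℂ) (h : lineRes r p = 0) :
    (X 0 - C r * X 1) ∣ p := by
  have h1 := aeval_sub_dvd p ![C r * X 1, X 1] (X 0 - C r * X 1) (by
    intro i; fin_cases i <;> simp)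
  have h2 : (aeval ![C r * X 1, X 1] : MvPolynomial (Fin 2) ℂ →ₐ[ℂ] _) =
      (Polynomial.aeval (X 1 : MvPolynomial (Fin 2) ℂ)).comp (lineRes r) := by
    apply MvPolynomial.algHom_ext
    intro i
    fin_cases i <;> simp [lineRes, MvPolynomial.algebraMap_eq]
  rw [h2, AlgHom.comp_apply, h, map_zero, sub_zero] at h1
  exact h1

theorem lineRes_prod (s : Finset ℂ) : ∀ p : MvPolynomial (Fin 2) ℂ, (∀ r ∈ s, lineRes r p = 0) →
    ∃ q, p = (∏ r ∈ s, (X 0 - C r * X 1)) * q := by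
  induction s using Finset.induction_on with
  | empty => intro p _; exact ⟨p, by simp⟩
  | insert a s ha ih =>
    intro p hp
    obtain ⟨q, hq⟩ := lineRes_dvd a p (hp a (by simp))
    obtain ⟨q', hq'⟩ := ih q (by
      intro r hr
      have h1 := hp r (by simp [hr])
      rw [hq, map_mul] at h1
      rcases mul_eq_zero.1 h1 with h | h
      · exfalso
        have h' : (Polynomial.C (r - a) : Polynomial ℂ) * Polynomial.X = 0 := by
          rw [← h]; simp [lineRes]; ring
        simp [sub_eq_zero] at h'
        exact ha (h' ▸ hr)
      · exact h)
    exact ⟨q', by rw [Finset.prod_insert ha, hq, hq', mul_assoc]⟩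

theorem X1_dvd {p : MvPolynomial (Fin 2) ℂ} {n : ℕ}
    (hp : p.IsHomogeneous n) (h : eval ![1, 0] p = 0) : X 1 ∣ p := by
  have h1 := aeval_sub_dvd p ![X 0, 0] (X 1) (by intro i; fin_cases i <;> simp)
  have h2 := hom_aeval hp 1 0 (X 0 : MvPolynomial (Fin 2) ℂ)
  rw [h] at h2
  simp only [map_one, one_mul, map_zero, zero_mul] at h2
  rwa [h2, sub_zero] at h1

theorem lineRes_zero {p : MvPolynomial (Fin 2) ℂ} {n : ℕ}
    (hp : p.IsHomogeneous n) (r : ℂ) (h : eval ![r, 1] p = 0) : lineRes r p = 0 := by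
  have h2 := hom_aeval hp r 1 (Polynomial.X : Polynomial ℂ)
  rw [h] at h2
  simpa [lineRes] using h2

theorem quot_hom {p g q : MvPolynomial (Fin 2) ℂ} {n m : ℕ}
    (hp : p.IsHomogeneous n) (hg : g.IsHomogeneous m) (h : p = g * q) :
    p = 0 ∨ (m ≤ n ∧ ∃ q' : MvPolynomial (Fin 2) ℂ, q'.IsHomogeneous (n - m) ∧ p = g * q') := by
  have h1 : p = ∑ i ∈ Finset.range (q.totalDegree + 1),
      homogeneousComponent n (g * homogeneousComponent i q) := by
    conv_lhs => rw [← homogeneousComponent_eq_self hp, h, ← sum_homogeneousComponent q,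
      Finset.mul_sum, map_sum]
  have h2 : ∀ i, homogeneousComponent n (g * homogeneousComponent i q) =
      if m + i = n then g * homogeneousComponent i q else 0 := fun i => by
    rw [homogeneousComponent_of_mem (hg.mul (homogeneousComponent_isHomogeneous i q))]
    simp only [eq_comm]
  simp only [h2] at h1
  by_cases hmn : m ≤ n
  · right
    refine ⟨hmn, ∑ i ∈ Finset.range (q.totalDegree + 1),
      if m + i = n then homogeneousComponent i q else 0, ?_, ?_⟩
    · apply IsHomogeneous.sum
      intro i _
      split_ifs with hi
      · rw [← hi, Nat.add_sub_cancel_left]; exact homogeneousComponent_isHomogeneous i q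
      · exact isHomogeneous_zero _ _ _
    · rw [Finset.mul_sum]
      simpa [mul_ite] using h1
  · left
    rw [h1]
    refine Finset.sum_eq_zero fun i _ => ?_
    rw [if_neg (by omega)]

noncomputable def sS (e : ℂ) : MvPolynomial (Fin 2) ℂ →ₐ[ℂ] MvPolynomial (Fin 2) ℂ :=
  aeval ![C (e ^ 3) * X 0, C (e ^ 2) * X 1]

noncomputable def sT (φ β : ℂ) : MvPolynomial (Fin 2) ℂ →ₐ[ℂ] MvPolynomial (Fin 2) ℂ :=
  aeval ![C (β * (-φ)) * X 0 + C β * X 1, C β * X 0 + C (β * φ) * X 1]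

theorem eval_sS (e a b : ℂ) (p : MvPolynomial (Fin 2) ℂ) :
    eval ![a, b] (sS e p) = eval ![e ^ 3 * a, e ^ 2 * b] p := by
  rw [sS, aeval_def, eval₂_eq', map_sum]
  conv_rhs => rw [eval_eq']
  simp [Fin.prod_univ_two, MvPolynomial.algebraMap_eq]

theorem eval_sT (φ β a b : ℂ) (p : MvPolynomial (Fin 2) ℂ) :
    eval ![a, b] (sT φ β p) = eval ![β * (-φ * a + b), β * (a + φ * b)] p := by
  rw [sT, aeval_def, eval₂_eq', map_sum]
  conv_rhs => rw [eval_eq']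
  simp [Fin.prod_univ_two, MvPolynomial.algebraMap_eq, mul_add, mul_assoc]

theorem ext_eval {p q : MvPolynomial (Fin 2) ℂ} (h : ∀ a b, eval ![a, b] p = eval ![a, b] q) :
    p = q := by
  apply MvPolynomial.funext
  intro x
  have : x = ![x 0, x 1] := by ext i; fin_cases i <;> rfl
  rw [this]; exact h _ _

/-- The numerical data. -/
structure Dat (e φ β : ℂ) : Prop where
  he : IsPrimitiveRoot e 5
  hφ : φ = 1 + e + e ^ 4
  hβ : 5 * β ^ 2 = φ - 3

namespace Dat
variable {e φ β : ℂ} (D : Dat e φ β)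

theorem sum (D : Dat e φ β) : 1 + e + e ^ 2 + e ^ 3 + e ^ 4 = 0 := by
  have := D.he.geom_sum_eq_zero (by norm_num)
  simpa [Finset.sum_range_succ] using this

theorem e5 (D : Dat e φ β) : e ^ 5 = 1 := D.he.pow_eq_one

theorem e0 (D : Dat e φ β) : e ≠ 0 := D.he.ne_zero (by norm_num)

theorem sq (D : Dat e φ β) : φ ^ 2 = φ + 1 := by
  rw [D.hφ]
  linear_combination (1 - e ^ 1 + e ^ 4 ) * D.sum + (2 - e - e ^ 2) * D.e5

theorem ratne (D : Dat e φ β) (q : ℚ) : φ ≠ q := by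
  intro h
  have h1 := D.sq
  rw [h] at h1
  have h2 : q ^ 2 = q + 1 := by exact_mod_cast h1
  have h3 : IsSquare (5 : ℚ) := ⟨2 * q - 1, by linear_combination -4 * h2⟩
  have h4 : IsSquare (5 : ℕ) := by
    have := Rat.isSquare_natCast_iff (n := 5)
    exact this.1 (by exact_mod_cast h3)
  have : ¬ IsSquare (5 : ℕ) := by
    rintro ⟨k, hk⟩
    have : k ≤ 2 := by nlinarith
    interval_cases k <;> omega
  exact this h4

theorem β0 (D : Dat e φ β) : β ≠ 0 := by
  intro h
  have := D.hβ
  rw [h] at this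
  exact D.ratne 3 (by push_cast; linear_combination -this)

theorem φ0 (D : Dat e φ β) : φ ≠ 0 := by
  intro h
  exact D.ratne 0 (by simpa using h)

theorem hF (D : Dat e φ β) : sS e icosF = icosF ∧ sT φ β icosF = icosF := by
  constructor <;> apply ext_eval <;> intro x y
  · rw [eval_sS]
    simp [icosF]
    have hu : (e ^ 3 * x) ^ 5 = x ^ 5 := by linear_combination (e ^ 10 + e ^ 5 + 1) * x ^ 5 * D.e5
    have hv : (e ^ 2 * y) ^ 5 = y ^ 5 := by linear_combination (e ^ 5 + 1) * y ^ 5 * D.e5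
    have huv : (e ^ 3 * x) * (e ^ 2 * y) = x * y := by linear_combination x * y * D.e5
    generalize e ^ 3 * x = u at *
    generalize e ^ 2 * y = v at *
    have : u * v * (u ^ 10 + 11 * u ^ 5 * v ^ 5 - v ^ 10) = u * v * ((u ^ 5) ^ 2 + 11 * u ^ 5 * v ^ 5 - (v ^ 5) ^ 2) := by ring
    rw [this, huv, hu, hv]; ring
  · rw [eval_sT]
    simp [icosF]
    have h1 := (icos_ids φ x y D.sq).1
    have h3 := D.hβ
    generalize x + φ * y = v at *
    have : -(φ * x) + y = -φ * x + y := by ring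
    rw [this]
    generalize -φ * x + y = u at *
    rw [← h3] at h1
    linear_combination (1 / 5 ^ 6) * h1

theorem hH (D : Dat e φ β) : sS e icosH = icosH ∧ sT φ β icosH = icosH := by
  constructor <;> apply ext_eval <;> intro x y
  · rw [eval_sS]
    simp [icosH]
    have hu : (e ^ 3 * x) ^ 5 = x ^ 5 := by linear_combination (e ^ 10 + e ^ 5 + 1) * x ^ 5 * D.e5
    have hv : (e ^ 2 * y) ^ 5 = y ^ 5 := by linear_combination (e ^ 5 + 1) * y ^ 5 * D.e5
    generalize e ^ 3 * x = u at *
    generalize e ^ 2 * y = v at *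
    have : ∀ u v : ℂ, -v ^ 20 + -u ^ 20 + 228 * (u ^ 15 * v ^ 5 - u ^ 5 * v ^ 15) - 494 * u ^ 10 * v ^ 10
      = -(v ^ 5) ^ 4 + -(u ^ 5) ^ 4 + 228 * ((u ^ 5) ^ 3 * v ^ 5 - u ^ 5 * (v ^ 5) ^ 3)
        - 494 * (u ^ 5) ^ 2 * (v ^ 5) ^ 2 := by intros; ring
    rw [this, hu, hv]; ring
  · rw [eval_sT]
    simp [icosH]
    have h1 := (icos_ids φ x y D.sq).2.1
    have h3 := D.hβ
    generalize x + φ * y = v at *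
    have : -(φ * x) + y = -φ * x + y := by ring
    rw [this]
    generalize -φ * x + y = u at *
    rw [← h3] at h1
    linear_combination (1 / 5 ^ 10) * h1

theorem hT (D : Dat e φ β) : sS e icosT = icosT ∧ sT φ β icosT = icosT := by
  constructor <;> apply ext_eval <;> intro x y
  · rw [eval_sS]
    simp [icosT]
    have hu : (e ^ 3 * x) ^ 5 = x ^ 5 := by linear_combination (e ^ 10 + e ^ 5 + 1) * x ^ 5 * D.e5
    have hv : (e ^ 2 * y) ^ 5 = y ^ 5 := by linear_combination (e ^ 5 + 1) * y ^ 5 * D.e5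
    generalize e ^ 3 * x = u at *
    generalize e ^ 2 * y = v at *
    have : u ^ 30 + v ^ 30 + 522 * (u ^ 25 * v ^ 5 - u ^ 5 * v ^ 25) -
        10005 * (u ^ 20 * v ^ 10 + u ^ 10 * v ^ 20)
      = (u ^ 5) ^ 6 + (v ^ 5) ^ 6 + 522 * ((u ^ 5) ^ 5 * v ^ 5 - u ^ 5 * (v ^ 5) ^ 5) -
        10005 * ((u ^ 5) ^ 4 * (v ^ 5) ^ 2 + (u ^ 5) ^ 2 * (v ^ 5) ^ 4) := by ring
    rw [this, hu, hv]; ring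
  · rw [eval_sT]
    simp [icosT]
    have h1 := (icos_ids φ x y D.sq).2.2
    have h3 := D.hβ
    generalize x + φ * y = v at *
    have : -(φ * x) + y = -φ * x + y := by ring
    rw [this]
    generalize -φ * x + y = u at *
    rw [← h3] at h1
    linear_combination (1 / 5 ^ 15) * h1

end Dat

theorem prod5 {R : Type*} [CommRing R] (E x z : R) (hE : 1 + E + E ^ 2 + E ^ 3 + E ^ 4 = 0) :
    ∏ k ∈ Finset.range 5, (x - z * E ^ k) = x ^ 5 - z ^ 5 := by
  simp only [Finset.prod_range_succ, Finset.prod_range_zero]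
  linear_combination (-x^4*z + E*(1+E^2)*x^3*z^2 - E^3*(1+E^2)*x^2*z^3 + E^6*x*z^4
    - z^5*(E-1)*(E^5+1)) * hE

theorem prod_line (e r : ℂ) (he : IsPrimitiveRoot e 5) (hr : r ≠ 0)
    (hE : 1 + e + e ^ 2 + e ^ 3 + e ^ 4 = 0) :
    ∏ t ∈ (Finset.range 5).image (fun k => r * e ^ k), (X 0 - C t * X 1 : MvPolynomial (Fin 2) ℂ)
      = X 0 ^ 5 - C (r ^ 5) * X 1 ^ 5 := by
  rw [Finset.prod_image]
  · have h := prod5 (C e : MvPolynomial (Fin 2) ℂ) (X 0) (C r * X 1) (by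
      rw [← map_one C, ← map_pow, ← map_pow, ← map_pow, ← map_add, ← map_add, ← map_add, ← map_add,
        hE, map_zero])
    rw [mul_pow, ← map_pow] at h
    rw [← h]
    refine Finset.prod_congr rfl fun k _ => ?_
    rw [map_mul, map_pow]; ring
  · intro i hi j hj hij
    simp only [mul_eq_mul_left_iff, hr, or_false] at hij
    exact he.pow_inj (by simpa using hi) (by simpa using hj) hij

namespace Dat
variable {e φ β : ℂ}

theorem icosF_dvd (D : Dat e φ β) {p : MvPolynomial (Fin 2) ℂ} {n : ℕ} (hp : p.IsHomogeneous n)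
    (h1 : sS e p = p) (h2 : sT φ β p = p) (h0 : eval ![1, 0] p = 0) : ∃ q, p = icosF * q := by
  have e5 := D.e5
  have sq := D.sq
  have hsum := D.sum
  have zc : ∀ c a b : ℂ, c ≠ 0 → eval ![c * a, c * b] p = 0 → eval ![a, b] p = 0 := by
    intro c a b hc h
    rw [hom_eval hp] at h
    exact (mul_eq_zero.1 h).resolve_left (pow_ne_zero _ hc)
  have zS : ∀ a b : ℂ, eval ![a, b] p = 0 → eval ![e * a, b] p = 0 := by
    intro a b h
    rw [← h1, eval_sS] at h
    apply zc (e ^ 2) _ _ (pow_ne_zero _ D.e0)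
    rw [← h]; congr 3; ring
  have zT : ∀ a b : ℂ, eval ![a, b] p = 0 → eval ![-φ * a + b, a + φ * b] p = 0 := by
    intro a b h
    rw [← h2, eval_sT] at h
    exact zc β _ _ D.β0 h
  have A : ∀ k : ℕ, eval ![-φ * e ^ k, 1] p = 0 := by
    intro k
    induction k with
    | zero => simpa using zT 1 0 h0
    | succ k ih => have := zS _ _ ih; rw [← this]; congr 3; ring
  have hne2 : e ^ 2 ≠ 1 := D.he.pow_ne_one_of_pos_of_lt (by norm_num) (by norm_num)
  have B2 : eval ![(φ - 1) * e ^ 2, 1] p = 0 := by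
    apply zc (φ * (1 - e ^ 2)) _ _ (mul_ne_zero D.φ0 (sub_ne_zero.2 hne2.symm))
    have := zT _ _ (A 2)
    rw [← this]
    congr 3
    · have hφ := D.hφ
      have : φ * (φ - 1) = 1 := by linear_combination sq
      have h' : -φ * (-φ * e ^ 2) + 1 = e ^ 2 * (φ + 1) + 1 := by linear_combination e ^ 2 * sq
      rw [h']
      have h'' : φ * (1 - e ^ 2) * ((φ - 1) * e ^ 2) = (1 - e ^ 2) * e ^ 2 := by
        linear_combination (1 - e ^ 2) * e ^ 2 * this
      rw [h'', hφ]
      linear_combination - hsum - e * e5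
    · ring
  have B : ∀ k : ℕ, eval ![(φ - 1) * e ^ (k + 2), 1] p = 0 := by
    intro k
    induction k with
    | zero => simpa using B2
    | succ k ih => have := zS _ _ ih; rw [← this]; congr 3; ring
  have B' : ∀ k : ℕ, eval ![(φ - 1) * e ^ k, 1] p = 0 := by
    intro k
    have := B (k + 3)
    rw [← this]
    congr 3
    linear_combination -(φ - 1) * e ^ k * e5
  have Z : eval ![0, 1] p = 0 := by
    apply zc (2 * φ - 1)
    · intro h; exact D.ratne (1 / 2) (by push_cast; linear_combination h / 2)
    · refine Eq.trans ?_ (zT _ _ (B' 0))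
      congr 3
      · linear_combination sq
      · ring
  obtain ⟨q0, hq0⟩ := X1_dvd hp h0
  have key : ∀ r, eval ![r, 1] p = 0 → lineRes r q0 = 0 := by
    intro r hr
    have := lineRes_zero hp r hr
    rw [hq0, map_mul] at this
    refine (mul_eq_zero.1 this).resolve_left ?_
    simp [lineRes]
  have hφ1 : φ - 1 ≠ 0 := by
    intro h; exact D.ratne 1 (by push_cast; linear_combination h)
  have hp5 : φ ^ 5 = 5 * φ + 3 := by
    linear_combination (φ ^ 3 + φ ^ 2 + 2 * φ + 3) * sq
  have hm5 : (φ - 1) ^ 5 = 5 * φ - 8 := by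
    linear_combination (φ ^ 3 - 4 * φ ^ 2 + 7 * φ - 7) * sq
  obtain ⟨q, hq⟩ := lineRes_prod
    (insert 0 ((Finset.range 5).image (fun k => (-φ) * e ^ k) ∪
      (Finset.range 5).image (fun k => (φ - 1) * e ^ k))) q0 (by
    intro r hr
    simp only [Finset.mem_insert, Finset.mem_union, Finset.mem_image] at hr
    rcases hr with rfl | ⟨k, -, rfl⟩ | ⟨k, -, rfl⟩
    · exact key _ Z
    · exact key _ (A k)
    · exact key _ (B' k))
  have e5k : ∀ k, (e ^ k) ^ 5 = 1 := by
    intro k; rw [← pow_mul, mul_comm, pow_mul, e5, one_pow]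
  rw [Finset.prod_insert, Finset.prod_union, prod_line e _ D.he (neg_ne_zero.2 D.φ0) hsum,
    prod_line e _ D.he hφ1 hsum] at hq
  · refine ⟨q, ?_⟩
    rw [hq0, hq, hm5, show (-φ) ^ 5 = -(5 * φ + 3) by rw [← hp5]; ring, icosF]
    have hc : C (-(5 * φ + 3)) + C (5 * φ - 8) = (-11 : MvPolynomial (Fin 2) ℂ) := by
      rw [← map_add, show -(5 * φ + 3) + (5 * φ - 8) = -11 by ring, map_neg, map_ofNat]
    have hd : C (-(5 * φ + 3)) * C (5 * φ - 8) = (-1 : MvPolynomial (Fin 2) ℂ) := by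
      rw [← map_mul, show -(5 * φ + 3) * (5 * φ - 8) = -1 by linear_combination -25 * sq,
        map_neg, map_one]
    rw [map_zero]
    linear_combination (X 1 * X 0 * q * (-X 0 ^ 5 * X 1 ^ 5)) * hc
      + (X 1 * X 0 * q * X 1 ^ 10) * hd
  · rw [Finset.disjoint_left]
    intro t ht ht'
    simp only [Finset.mem_image] at ht ht'
    obtain ⟨k, -, rfl⟩ := ht
    obtain ⟨j, -, hj⟩ := ht'
    have h5 := congrArg (· ^ 5) hj
    simp only [mul_pow, e5k, hm5, mul_one] at h5
    exact D.ratne (1 / 2) (by push_cast; linear_combination (h5 - hp5) / 10)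
  · simp only [Finset.mem_union, Finset.mem_image, mul_eq_zero, not_or]
    simp [D.φ0, hφ1, D.e0]

theorem deg10 (D : Dat e φ β) {p : MvPolynomial (Fin 2) ℂ} (hp : p.IsHomogeneous 10)
    (h1 : sS e p = p) (h2 : sT φ β p = p) : eval ![1, 0] p = 0 := by
  have e5 := D.e5
  have sq := D.sq
  have hsum := D.sum
  obtain ⟨c, hc⟩ : ∃ c : ℕ → ℂ, ∀ x y, eval ![x, y] p =
      ∑ i ∈ Finset.range 11, c i * x ^ i * y ^ (10 - i) := by
    refine ⟨fun i => ∑ d ∈ p.support with d 0 = i, coeff d p, fun x y => ?_⟩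
    have hd : ∀ d ∈ p.support, d 0 + d 1 = 10 := by
      intro d hd
      rw [hp.degree_eq_sum_deg_support hd]; change _ = d.degree
      rw [Finsupp.degree_eq_sum]; simp
    rw [eval_eq', ← Finset.sum_fiberwise_of_maps_to (s := p.support) (t := Finset.range 11)
      (g := fun d => d 0) (fun d hd' => by have := hd d hd'; simp; omega)]
    refine Finset.sum_congr rfl fun i _ => ?_
    rw [Finset.sum_mul, Finset.sum_mul]
    refine Finset.sum_congr rfl fun d hd' => ?_
    rw [Finset.mem_filter] at hd'
    have h3 := hd d hd'.1
    have h4 : d 1 = 10 - i := by omega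
    rw [Fin.prod_univ_two, h4, hd'.2]
    simp [mul_assoc]
  have hS : ∀ x y, eval ![e * x, y] p = eval ![x, y] p := by
    intro x y
    have h3 := eval_sS e x y p
    rw [h1] at h3
    have h4 := hom_eval hp (e * x) y (e ^ 2)
    rw [show e ^ 2 * (e * x) = e ^ 3 * x by ring, ← h3] at h4
    rw [h4, show (e ^ 2) ^ 10 = (e ^ 5) ^ 4 by ring, e5]; ring
  have hS' : ∀ k : ℕ, ∀ x y, eval ![e ^ k * x, y] p = eval ![x, y] p := by
    intro k x y
    induction k with
    | zero => simp
    | succ k ih => rw [pow_succ', mul_assoc, hS, ih]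
  have z : ∀ i, ¬ 5 ∣ i → 1 + e ^ i + e ^ (2 * i) + e ^ (3 * i) + e ^ (4 * i) = 0 := by
    intro i hi
    have h3 : e ^ i ≠ 1 := fun h => hi (D.he.pow_eq_one_iff_dvd i |>.1 h)
    have h4 : (e ^ i) ^ 5 = 1 := by rw [← pow_mul, mul_comm, pow_mul, e5, one_pow]
    have h5 : (e ^ i - 1) * (1 + e ^ i + e ^ (2 * i) + e ^ (3 * i) + e ^ (4 * i)) = 0 := by
      linear_combination h4
    exact (mul_eq_zero.1 h5).resolve_left (sub_ne_zero.2 h3)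
  have P : ∀ x y, eval ![x, y] p = c 0 * y ^ 10 + c 5 * x ^ 5 * y ^ 5 + c 10 * x ^ 10 := by
    intro x y
    have a1 := hS' 1 x y
    have a2 := hS' 2 x y
    have a3 := hS' 3 x y
    have a4 := hS' 4 x y
    rw [hc, hc] at a1 a2 a3 a4
    rw [hc]
    simp only [Finset.sum_range_succ, Finset.sum_range_zero, Nat.reduceSub] at *
    have z1 := z 1 (by norm_num)
    have z2 := z 2 (by norm_num)
    have z3 := z 3 (by norm_num)
    have z4 := z 4 (by norm_num)
    have z6 := z 6 (by norm_num)
    have z7 := z 7 (by norm_num)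
    have z8 := z 8 (by norm_num)
    have z9 := z 9 (by norm_num)
    have w10 : 1 + e ^ 10 + e ^ 20 + e ^ 30 + e ^ 40 = 5 := by
      linear_combination ((e^5+1) + (e^15+e^10+e^5+1) + (e^25+e^20+e^15+e^10+e^5+1)
        + (e^35+e^30+e^25+e^20+e^15+e^10+e^5+1)) * e5
    have w5 : 1 + e ^ 5 + e ^ 10 + e ^ 15 + e ^ 20 = 5 := by
      linear_combination (1 + (e^5+1) + (e^10+e^5+1) + (e^15+e^10+e^5+1)) * e5
    linear_combination (-1/5) * (a1 + a2 + a3 + a4) + (1/5) * (c 1 * x * y ^ 9 * z1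
      + c 2 * x ^ 2 * y ^ 8 * z2 + c 3 * x ^ 3 * y ^ 7 * z3 + c 4 * x ^ 4 * y ^ 6 * z4
      + c 6 * x ^ 6 * y ^ 4 * z6 + c 7 * x ^ 7 * y ^ 3 * z7 + c 8 * x ^ 8 * y ^ 2 * z8
      + c 9 * x ^ 9 * y * z9 + c 5 * x ^ 5 * y ^ 5 * w5 + c 10 * x ^ 10 * w10)
  have hB : β ^ 10 = (11 * φ - 18) / 125 := by
    have : β ^ 10 = (φ - 3) ^ 5 / 5 ^ 5 := by rw [← D.hβ]; ring
    rw [this]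
    have : (φ - 3) ^ 5 = 25 * (11 * φ - 18) := by
      linear_combination (φ ^ 3 - 14 * φ ^ 2 + 77 * φ - 207) * sq
    rw [this]; ring
  have hTT : ∀ x y, β ^ 10 * eval ![-φ * x + y, x + φ * y] p = eval ![x, y] p := by
    intro x y
    rw [← hom_eval hp, ← eval_sT, h2]
  have p5 : φ ^ 5 = 5 * φ + 3 := by
    linear_combination (φ ^ 3 + φ ^ 2 + 2 * φ + 3) * sq
  have p10 : φ ^ 10 = 55 * φ + 34 := by
    linear_combination (φ ^ 5 + 5 * φ + 3) * p5 + 25 * sq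
  have E1 := hTT 1 0
  have E2 := hTT 0 1
  have E3 := hTT 1 1
  rw [P, P, hB] at E1 E2 E3
  have m5 : (1 - φ) ^ 5 = 8 - 5 * φ := by
    linear_combination (-φ ^ 3 + 4 * φ ^ 2 - 7 * φ + 7) * sq
  have m10 : (1 - φ) ^ 10 = 89 - 55 * φ := by
    linear_combination ((1 - φ) ^ 5 + 8 - 5 * φ) * m5 + 25 * sq
  have q5 : (1 + φ) ^ 5 = 55 * φ + 34 := by
    rw [← p10, add_comm, ← sq]; ring
  have q10 : (1 + φ) ^ 10 = 6765 * φ + 4181 := by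
    linear_combination ((1 + φ) ^ 5 + 55 * φ + 34) * q5 + 3025 * sq
  have E1' : (11 * φ - 18) * (c 0 - c 5 * (5 * φ + 3) + c 10 * (55 * φ + 34)) = 125 * c 10 := by
    rw [← p5, ← p10]; linear_combination 125 * E1
  have E2' : (11 * φ - 18) * (c 10 + c 5 * (5 * φ + 3) + c 0 * (55 * φ + 34)) = 125 * c 0 := by
    rw [← p5, ← p10]; linear_combination 125 * E2
  have E3' : (11 * φ - 18) * (c 10 * (89 - 55 * φ) + c 5 * ((8 - 5 * φ) * (55 * φ + 34))
      + c 0 * (6765 * φ + 4181)) = 125 * (c 0 + c 5 + c 10) := by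
    rw [← m5, ← m10, ← q5, ← q10]; linear_combination 125 * E3
  clear E1 E2 E3 hTT hS hS' hc z
  have s1 : c 0 = - c 10 := by
    linear_combination (-1/150) * (E1' + E2') + (1/150) * 605 * (c 0 + c 10) * sq
  rw [s1] at E1' E3'
  have s2 : c 10 * (114 + 22 * φ) = c 5 * (2 * φ - 1) := by
    linear_combination -E1' + (c 10 * 605 - c 5 * 55) * sq
  have s3 : c 5 = c 10 * (50 * φ - 14) := by
    linear_combination (-1/5) * (2 * φ - 1) * s2 + (1/5) * (44 * c 10 - 4 * c 5) * sq
  have s4 : c 10 * (7 * φ - 1) = 0 := by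
    have t : c 10 * (2728 * φ - 1364) = c 5 * (126 - 2 * φ) := by
      linear_combination E3' - (-75020 * c 10 + c 5 * ((11 * φ - 18) * (-275) - 55)) * sq
    linear_combination (-1/500) * (t + (126 - 2 * φ) * s3 - 100 * c 10 * sq)
  have s5 : c 10 = 0 := by
    refine (mul_eq_zero.1 s4).resolve_right fun h => D.ratne (1 / 7) ?_
    push_cast; linear_combination h / 7
  rw [P]; simp [s5]

end Dat

theorem icosF_hom : icosF.IsHomogeneous 12 := by
  have x := fun k => isHomogeneous_X_pow (R := ℂ) (0 : Fin 2) k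
  have y := fun k => isHomogeneous_X_pow (R := ℂ) (1 : Fin 2) k
  have h : icosF = X 0 ^ 11 * X 1 ^ 1 + C 11 * (X 0 ^ 6 * X 1 ^ 6) - X 0 ^ 1 * X 1 ^ 11 := by
    rw [icosF, map_ofNat]; ring
  rw [h]
  exact (((x 11).mul (y 1)).add (((x 6).mul (y 6)).C_mul _)).sub ((x 1).mul (y 11))

theorem icosH_hom : icosH.IsHomogeneous 20 := by
  have x := fun k => isHomogeneous_X_pow (R := ℂ) (0 : Fin 2) k
  have y := fun k => isHomogeneous_X_pow (R := ℂ) (1 : Fin 2) k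
  have h : icosH = -(X 0 ^ 20 + X 1 ^ 20) + C 228 * (X 0 ^ 15 * X 1 ^ 5 - X 0 ^ 5 * X 1 ^ 15)
      - C 494 * (X 0 ^ 10 * X 1 ^ 10) := by
    rw [icosH, map_ofNat, map_ofNat]; ring
  rw [h]
  exact (((x 20).add (y 20)).neg.add ((((x 15).mul (y 5)).sub ((x 5).mul (y 15))).C_mul _)).sub
    (((x 10).mul (y 10)).C_mul _)

theorem icosT_hom : icosT.IsHomogeneous 30 := by
  have x := fun k => isHomogeneous_X_pow (R := ℂ) (0 : Fin 2) k
  have y := fun k => isHomogeneous_X_pow (R := ℂ) (1 : Fin 2) k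
  have h : icosT = (X 0 ^ 30 + X 1 ^ 30) + C 522 * (X 0 ^ 25 * X 1 ^ 5 - X 0 ^ 5 * X 1 ^ 25)
      - C 10005 * (X 0 ^ 20 * X 1 ^ 10 + X 0 ^ 10 * X 1 ^ 20) := by
    rw [icosT, map_ofNat, map_ofNat]
  rw [h]
  exact (((x 30).add (y 30)).add ((((x 25).mul (y 5)).sub ((x 5).mul (y 25))).C_mul _)).sub
    ((((x 20).mul (y 10)).add ((x 10).mul (y 20))).C_mul _)

theorem icosF_ne : icosF ≠ 0 := by
  intro h
  have := congrArg (eval ![1, 1]) h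
  simp [icosF] at this

namespace Dat
variable {e φ β : ℂ}

theorem vanish (D : Dat e φ β) {p : MvPolynomial (Fin 2) ℂ} {n : ℕ} (hp : p.IsHomogeneous n)
    (h1 : sS e p = p) (h2 : sT φ β p = p) (hn : ¬ 10 ∣ n) : eval ![1, 0] p = 0 := by
  by_cases h5 : 5 ∣ n
  · have hodd : Odd n := by
      rw [← Nat.not_even_iff_odd, even_iff_two_dvd]; omega
    have a := eval_sT φ β 1 0 p
    have b := eval_sT φ β (β * (-φ * 1 + 0)) (β * (1 + φ * 0)) p
    rw [h2] at a b
    have c := hom_eval hp 1 0 (-1)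
    have d : eval ![-1 * 1, -1 * 0] p = eval ![1, 0] p := by
      rw [a, b]
      congr 3
      · linear_combination -(β ^ 2) * D.sq - (φ + 2) / 5 * D.hβ - (1 / 5) * D.sq
      · ring
    rw [hodd.neg_one_pow, d] at c
    linear_combination c / 2
  · have a := eval_sS e 1 0 p
    rw [h1, mul_zero, mul_one] at a
    have c := hom_eval hp 1 0 (e ^ 3)
    rw [mul_one, mul_zero, ← a, ← pow_mul] at c
    have h3 : e ^ (3 * n) ≠ 1 := fun h => h5 (by
      have := (D.he.pow_eq_one_iff_dvd _).1 h
      omega)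
    have : (e ^ (3 * n) - 1) * eval ![1, 0] p = 0 := by linear_combination -c
    exact (mul_eq_zero.1 this).resolve_left (sub_ne_zero.2 h3)

theorem main (D : Dat e φ β) : ∀ n : ℕ, ∀ p : MvPolynomial (Fin 2) ℂ, p.IsHomogeneous n →
    sS e p = p → sT φ β p = p →
    p ∈ Algebra.adjoin ℂ ({icosF, icosH, icosT} : Set (MvPolynomial (Fin 2) ℂ)) := by
  intro n
  induction n using Nat.strong_induction_on with
  | _ n ih =>
  intro p hp h1 h2
  have mF : icosF ∈ Algebra.adjoin ℂ ({icosF, icosH, icosT} : Set (MvPolynomial (Fin 2) ℂ)) :=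
    Algebra.subset_adjoin (by simp)
  have mH : icosH ∈ Algebra.adjoin ℂ ({icosF, icosH, icosT} : Set (MvPolynomial (Fin 2) ℂ)) :=
    Algebra.subset_adjoin (by simp)
  have mT : icosT ∈ Algebra.adjoin ℂ ({icosF, icosH, icosT} : Set (MvPolynomial (Fin 2) ℂ)) :=
    Algebra.subset_adjoin (by simp)
  have red : ∀ p : MvPolynomial (Fin 2) ℂ, p.IsHomogeneous n → sS e p = p → sT φ β p = p →
      eval ![1, 0] p = 0 →
      p ∈ Algebra.adjoin ℂ ({icosF, icosH, icosT} : Set (MvPolynomial (Fin 2) ℂ)) := by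
    intro p hp h1 h2 h0
    obtain ⟨q0, hq0⟩ := D.icosF_dvd hp h1 h2 h0
    rcases quot_hom hp icosF_hom hq0 with h | ⟨hle, q, hq, hpq⟩
    · rw [h]; exact Subalgebra.zero_mem _
    · rw [hpq]
      refine Subalgebra.mul_mem _ mF (ih (n - 12) (by omega) q hq ?_ ?_)
      · apply mul_left_cancel₀ icosF_ne
        rw [hpq, map_mul, D.hF.1] at h1; exact h1
      · apply mul_left_cancel₀ icosF_ne
        rw [hpq, map_mul, D.hF.2] at h2; exact h2
  by_cases h10 : 10 ∣ n
  swap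
  · exact red p hp h1 h2 (D.vanish hp h1 h2 h10)
  by_cases hn10 : n = 10
  · exact red p hp h1 h2 (by subst hn10; exact D.deg10 hp h1 h2)
  obtain ⟨a, b, hab⟩ : ∃ a b : ℕ, 20 * a + 30 * b = n := by
    obtain ⟨k, rfl⟩ := h10
    rcases Nat.even_or_odd' k with ⟨c, rfl | rfl⟩
    · exact ⟨c, 0, by omega⟩
    · exact ⟨c - 1, 1, by omega⟩
  have hr : (icosH ^ a * icosT ^ b).IsHomogeneous n := by
    rw [← hab]; exact (icosH_hom.pow a).mul (icosT_hom.pow b)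
  have er : eval ![1, 0] (icosH ^ a * icosT ^ b) = (-1) ^ a := by
    simp [icosH, icosT]
  have mr : C (eval ![1, 0] p * (-1) ^ a) * (icosH ^ a * icosT ^ b) ∈
      Algebra.adjoin ℂ ({icosF, icosH, icosT} : Set (MvPolynomial (Fin 2) ℂ)) :=
    Subalgebra.mul_mem _ (Subalgebra.algebraMap_mem _ _)
      (Subalgebra.mul_mem _ (Subalgebra.pow_mem _ mH a) (Subalgebra.pow_mem _ mT b))
  have hC : ∀ (s : MvPolynomial (Fin 2) ℂ →ₐ[ℂ] MvPolynomial (Fin 2) ℂ) (c : ℂ), s (C c) = C c :=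
    fun s c => s.commutes c
  have := red (p - C (eval ![1, 0] p * (-1) ^ a) * (icosH ^ a * icosT ^ b))
    (hp.sub (hr.C_mul _))
    (by rw [map_sub, map_mul (sS e) (C _), map_mul (sS e) (_ ^ _), map_pow (sS e) _ _, map_pow (sS e) _ _, D.hH.1, D.hT.1, h1, hC])
    (by rw [map_sub, map_mul (sT φ β) (C _), map_mul (sT φ β) (_ ^ _), map_pow (sT φ β) _ _, map_pow (sT φ β) _ _, D.hH.2, D.hT.2, h2, hC])
    (by
      rw [map_sub, map_mul, er, eval_C, mul_assoc, ← mul_pow]; simp)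
  have := Subalgebra.add_mem _ this mr
  simpa using this

end Dat

theorem comp_inv (g : Fin 2 → MvPolynomial (Fin 2) ℂ) (hg : ∀ i, (g i).IsHomogeneous 1)
    (p : MvPolynomial (Fin 2) ℂ) (h : aeval g p = p) (n : ℕ) :
    aeval g (homogeneousComponent n p) = homogeneousComponent n p := by
  have hh : ∀ i, (aeval g (homogeneousComponent i p)).IsHomogeneous i := by
    intro i
    have := (homogeneousComponent_isHomogeneous i p).aeval g hg
    simpa using this
  conv_rhs => rw [← h]
  conv_rhs => rw [← sum_homogeneousComponent p, map_sum, map_sum]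
  rw [Finset.sum_congr rfl (fun i _ => homogeneousComponent_of_mem (m := n) (n := i) (hh i))]
  simp only [eq_comm (a := n)]
  rw [Finset.sum_ite_eq' (Finset.range (p.totalDegree + 1)) n]
  split_ifs with hn
  · rfl
  · rw [homogeneousComponent_eq_zero _ _ (by simpa using hn), map_zero]

/-- Every polynomial invariant under the icosahedral group lies in the subalgebra generated
by `f`, `H` and `T`: `ℂ[z₁,z₂]^Γ = ℂ[f,H,T]`. -/
theorem invariants_eq_adjoin_fHT (p : MvPolynomial (Fin 2) ℂ)
    (hS : aeval (R := ℂ)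
      ![C (exp (2 * Real.pi * I / 5) ^ 3) * X 0,
        C (exp (2 * Real.pi * I / 5) ^ 2) * X 1] p = p)
    (hT : aeval (R := ℂ)
      ![C (-(exp (2 * Real.pi * I / 5) - exp (2 * Real.pi * I / 5) ^ 4) /
            (Real.sqrt 5 : ℂ)) * X 0 +
        C ((exp (2 * Real.pi * I / 5) ^ 2 - exp (2 * Real.pi * I / 5) ^ 3) /
            (Real.sqrt 5 : ℂ)) * X 1,
        C ((exp (2 * Real.pi * I / 5) ^ 2 - exp (2 * Real.pi * I / 5) ^ 3) /
            (Real.sqrt 5 : ℂ)) * X 0 +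
        C ((exp (2 * Real.pi * I / 5) - exp (2 * Real.pi * I / 5) ^ 4) /
            (Real.sqrt 5 : ℂ)) * X 1] p = p) :
    p ∈ Algebra.adjoin ℂ ({icosF, icosH, icosT} : Set (MvPolynomial (Fin 2) ℂ)) := by
  have he := Complex.isPrimitiveRoot_exp 5 (by norm_num)
  have hee : (2 * Real.pi * I / (5 : ℕ) : ℂ) = 2 * Real.pi * I / 5 := by norm_num
  rw [hee] at he
  generalize exp (2 * Real.pi * I / 5) = e at *
  have hs : (Real.sqrt 5 : ℂ) ^ 2 = 5 := by
    rw [← Complex.ofReal_pow, Real.sq_sqrt (by norm_num)]; norm_num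
  generalize (Real.sqrt 5 : ℂ) = s at *
  have hs0 : s ≠ 0 := by rintro rfl; norm_num at hs
  have e5 : e ^ 5 = 1 := he.pow_eq_one
  have hsum : 1 + e + e ^ 2 + e ^ 3 + e ^ 4 = 0 := by
    have := he.geom_sum_eq_zero (by norm_num)
    simpa [Finset.sum_range_succ] using this
  have D : Dat e (1 + e + e ^ 4) ((e ^ 2 - e ^ 3) / s) := by
    refine ⟨he, rfl, ?_⟩
    rw [div_pow, hs]
    linear_combination (e - 2) * e5
  have k : (e ^ 2 - e ^ 3) * (1 + e + e ^ 4) = e - e ^ 4 := by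
    linear_combination (e - e ^ 2) * e5
  have k1 : (e ^ 2 - e ^ 3) / s * (-(1 + e + e ^ 4)) = -(e - e ^ 4) / s := by
    rw [← k]; ring
  have k2 : (e ^ 2 - e ^ 3) / s * (1 + e + e ^ 4) = (e - e ^ 4) / s := by
    rw [← k]; ring
  rw [← k1, ← k2] at hT
  rw [← sum_homogeneousComponent p]
  refine Subalgebra.sum_mem _ fun n _ => ?_
  refine D.main n _ (homogeneousComponent_isHomogeneous n p) ?_ ?_
  · refine comp_inv _ ?_ p hS n
    intro i
    fin_cases i
    · exact isHomogeneous_C_mul_X _ _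
    · exact isHomogeneous_C_mul_X _ _
  · refine comp_inv _ ?_ p hT n
    intro i
    fin_cases i
    · exact (isHomogeneous_C_mul_X _ _).add (isHomogeneous_C_mul_X _ _)
    · exact (isHomogeneous_C_mul_X _ _).add (isHomogeneous_C_mul_X _ _)
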